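/- arXiv:1005.5662 — 3 statements merged into one kernel-verified Lean document; each statement's English description precedes it below -/
import Mathlib

section
/- For every k ∈ ℕ and every partial function F from Bool^k to Bool, there exists a loop-free PGLB_bt instruction sequence I such that: I contains no backward jump, no instruction of I refers to an auxiliary register, the length of I is exactly 3·2^k − 2, and I computes F using 0 auxiliary registers. -/
/-- A focus (register name): an input register `in:i` or an auxiliary register `aux:i`. -/
inductive Focus
  | inp (i : ℕ)
  | aux (i : ℕ)
  deriving DecidableEq

/-- A method of a Boolean register service. -/
inductive Method
  | setT
  | setF
  | get
  deriving DecidableEq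

/-- A PGLB_bt primitive instruction. -/
inductive Instr
  | basic (f : Focus) (m : Method)   -- f.m
  | pos (f : Focus) (m : Method)     -- +f.m
  | neg (f : Focus) (m : Method)     -- -f.m
  | fjmp (l : ℕ)                     -- #l
  | bjmp (l : ℕ)                     -- \#l
  | termT                            -- !t
  | termF                            -- !f
  deriving DecidableEq

/-- A state assigns to every register a value in {t, f, d}; `none` represents `d`. -/
abbrev St := Focus → Option Bool

/-- The reply produced when processing method `m` on a register holding `x`. -/
def procReply (m : Method) (x : Option Bool) : Option Bool :=
  match x, m with
  | none, _ => none
  | some b, .get => some b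
  | some _, .setT => some true
  | some _, .setF => some true

/-- The new register value after processing method `m` on a register holding `x`. -/
def procEff (m : Method) (x : Option Bool) : Option Bool :=
  match x, m with
  | none, _ => none
  | some b, .get => some b
  | some _, .setT => some true
  | some _, .setF => some false

/-- Update a state by processing method `m` on the register named `f`. -/
def updSt (s : St) (f : Focus) (m : Method) : St :=
  fun g => if g = f then procEff m (s f) else s g

/-- An execution configuration: running at a (1-based) position in a state,
terminated with a reply (recording the final state), or deadlocked. -/
inductive Config
  | running (i : ℕ) (s : St)
  | terminated (r : Bool) (s : St)
  | deadlock

/-- One execution step of the instruction sequence `I`. -/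
def step (I : List Instr) : Config → Config
  | .terminated r s => .terminated r s
  | .deadlock => .deadlock
  | .running i s =>
    if i = 0 then .deadlock
    else
      match I[i - 1]? with
      | none => .deadlock
      | some u =>
        match u with
        | .basic f m =>
          match procReply m (s f) with
          | none => .deadlock
          | some _ => .running (i + 1) (updSt s f m)
        | .pos f m =>
          match procReply m (s f) with
          | none => .deadlock
          | some true => .running (i + 1) (updSt s f m)
          | some false => .running (i + 2) (updSt s f m)
        | .neg f m =>
          match procReply m (s f) with
          | none => .deadlock
          | some true => .running (i + 2) (updSt s f m)
          | some false => .running (i + 1) (updSt s f m)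
        | .fjmp l => .running (i + l) s
        | .bjmp l => if l < i then .running (i - l) s else .deadlock
        | .termT => .terminated true s
        | .termF => .terminated false s

/-- The configuration after `n` execution steps of `I`, starting at position 1 in state `s`. -/
def run (I : List Instr) (s : St) (n : ℕ) : Config :=
  (step I)^[n] (.running 1 s)

/-- Execution of `I` from state `s` terminates with reply `r`. -/
def TermWith (I : List Instr) (s : St) (r : Bool) : Prop :=
  ∃ n s', run I s n = .terminated r s'

/-- An instruction sequence is loop-free if it contains no backward jump. -/
def LoopFree (I : List Instr) : Prop := ∀ l, Instr.bjmp l ∉ I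

/-- An instruction refers to an auxiliary register. -/
def UsesAux : Instr → Prop
  | .basic (.aux _) _ => True
  | .pos (.aux _) _ => True
  | .neg (.aux _) _ => True
  | _ => False

/-- The initial state for computing a `k`-ary function using `l` auxiliary registers:
`in:i` holds `b_i` for `1 ≤ i ≤ k`, `aux:j` holds `t` for `1 ≤ j ≤ l`,
all other registers hold `d`. -/
def initSt (k l : ℕ) (b : Fin k → Bool) : St
  | .inp i => if h : 1 ≤ i ∧ i ≤ k then some (b ⟨i - 1, by omega⟩) else none
  | .aux j => if 1 ≤ j ∧ j ≤ l then some true else none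

/-- `I` computes the partial function `F : Bool^k ⇀ Bool` using `l` auxiliary registers. -/
def Computes (I : List Instr) (k l : ℕ) (F : (Fin k → Bool) → Option Bool) : Prop :=
  ∀ b : Fin k → Bool,
    (∀ r : Bool, F b = some r → TermWith I (initSt k l b) r) ∧
    (F b = none → ∀ r : Bool, ¬ TermWith I (initSt k l b) r)

/-- The instruction producing a given outcome: termination with a reply, or the
self-loop `#0` if the outcome is undefined. -/
def outcomeInstr : Option Bool → Instr
  | some true => .termT
  | some false => .termF
  | none => .fjmp 0

/-- The decision-tree instruction sequence for `F`, with the arguments of `F` read from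
the input registers `in:(o+1), …, in:(o+k)`. -/
def decisionTree : (k o : ℕ) → ((Fin k → Bool) → Option Bool) → List Instr
  | 0, _, F => [outcomeInstr (F Fin.elim0)]
  | k + 1, o, F =>
    .neg (.inp (o + 1)) .get :: .fjmp (3 * 2 ^ k - 2 + 1) ::
      (decisionTree k (o + 1) (fun b => F (Fin.cons true b)) ++
        decisionTree k (o + 1) (fun b => F (Fin.cons false b)))

theorem length_decisionTree (k o : ℕ) (F : (Fin k → Bool) → Option Bool) :
    (decisionTree k o F).length = 3 * 2 ^ k - 2 := by
  induction k generalizing o with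
  | zero => simp [decisionTree]
  | succ k ih =>
    simp only [decisionTree, List.length_cons, List.length_append, ih, pow_succ]
    have := Nat.one_le_two_pow (n := k)
    omega

theorem mem_decisionTree {k o : ℕ} {F : (Fin k → Bool) → Option Bool} {u : Instr}
    (hu : u ∈ decisionTree k o F) :
    (∃ i, u = .neg (.inp i) .get) ∨ (∃ l, u = .fjmp l) ∨ u = .termT ∨ u = .termF := by
  induction k generalizing o with
  | zero =>
    simp only [decisionTree, List.mem_singleton] at hu
    subst hu
    rcases F Fin.elim0 with _ | _ | _ <;> simp [outcomeInstr]
  | succ k ih =>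
    simp only [decisionTree, List.mem_cons, List.mem_append] at hu
    rcases hu with rfl | rfl | hu | hu
    · simp
    · simp
    · exact ih hu
    · exact ih hu

theorem updSt_get (s : St) (f : Focus) : updSt s f .get = s := by
  funext g
  unfold updSt
  split_ifs with h
  · subst h
    cases s g <;> rfl
  · rfl

theorem step_neg_get {I : List Instr} {p : ℕ} {s : St} {f : Focus} {x : Bool}
    (hI : I[p]? = some (.neg f .get)) (hs : s f = some x) :
    step I (.running (p + 1) s) = .running (p + 1 + if x then 2 else 1) s := by
  cases x <;> simp [step, hI, hs, procReply, updSt_get]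

theorem step_fjmp {I : List Instr} {p l : ℕ} {s : St} (hI : I[p]? = some (.fjmp l)) :
    step I (.running (p + 1) s) = .running (p + 1 + l) s := by
  simp [step, hI]

/-- Execution of a decision tree embedded in a larger instruction sequence reaches the
instruction producing the outcome for the current inputs, without changing the state. -/
theorem decisionTree_reaches (k o : ℕ) (F : (Fin k → Bool) → Option Bool)
    (b : Fin k → Bool) (s : St) (hs : ∀ i : Fin k, s (.inp (o + 1 + i)) = some (b i))
    (pre post : List Instr) :
    ∃ n q, (step (pre ++ decisionTree k o F ++ post))^[n] (.running (pre.length + 1) s) =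
        .running (q + 1) s ∧
      (pre ++ decisionTree k o F ++ post)[q]? = some (outcomeInstr (F b)) := by
  induction k generalizing o pre post with
  | zero =>
    refine ⟨0, pre.length, rfl, ?_⟩
    simp [decisionTree, Subsingleton.elim b Fin.elim0]
  | succ k ih =>
    have htail : ∀ i : Fin k, s (.inp (o + 1 + 1 + i)) = some (Fin.tail b i) := by
      intro i
      have := hs i.succ
      rw [Fin.val_succ] at this
      rw [show o + 1 + 1 + (i : ℕ) = o + 1 + (i + 1) by omega]
      exact this
    have hhead : s (.inp (o + 1)) = some (b 0) := hs 0
    have hb : b = Fin.cons (b 0) (Fin.tail b) := (Fin.cons_self_tail b).symm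
    set T := decisionTree k (o + 1) (fun b => F (Fin.cons true b)) with hT
    set E := decisionTree k (o + 1) (fun b => F (Fin.cons false b)) with hE
    have hlen : T.length = 3 * 2 ^ k - 2 := length_decisionTree _ _ _
    set test : List Instr := [.neg (.inp (o + 1)) .get, .fjmp (3 * 2 ^ k - 2 + 1)] with htest
    have hdec : decisionTree (k + 1) o F = test ++ T ++ E := by
      simp [decisionTree, htest, hT, hE]
    rw [hdec]
    set I := pre ++ (test ++ T ++ E) ++ post with hI
    have h0 : I[pre.length]? = some (.neg (.inp (o + 1)) .get) := by simp [hI, htest]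
    have h1 : I[pre.length + 1]? = some (.fjmp (3 * 2 ^ k - 2 + 1)) := by
      simp [hI, htest]
    have hstep := step_neg_get h0 hhead
    cases hx : b 0 with
    | true =>
      obtain ⟨n, q, hn, hq⟩ := ih (o + 1) (fun b => F (Fin.cons true b)) (Fin.tail b) htail
        (pre ++ test) (E ++ post)
      have hI' : pre ++ test ++ T ++ (E ++ post) = I := by simp [hI]
      rw [← hT, hI'] at hn hq
      refine ⟨n + 1, q, ?_, ?_⟩
      · rw [Function.iterate_succ_apply, hstep, hx, ← hn]
        simp [htest, add_right_comm]
      · rw [hq, hb, hx, Fin.tail_cons]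
    | false =>
      obtain ⟨n, q, hn, hq⟩ := ih (o + 1) (fun b => F (Fin.cons false b)) (Fin.tail b) htail
        (pre ++ test ++ T) post
      have hI' : pre ++ test ++ T ++ E ++ post = I := by simp [hI]
      rw [← hE, hI'] at hn hq
      refine ⟨n + 1 + 1, q, ?_, ?_⟩
      · rw [Function.iterate_succ_apply, hstep, hx, Function.iterate_succ_apply]
        simp only [Bool.false_eq_true, if_false]
        rw [step_fjmp h1, ← hn]
        congr 2
        simp only [htest, List.length_append, List.length_cons, List.length_nil, hlen]
        omega
      · rw [hq, hb, hx, Fin.tail_cons]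

theorem computes_decisionTree (k l : ℕ) (F : (Fin k → Bool) → Option Bool) :
    Computes (decisionTree k 0 F) k l F := by
  intro b
  have hs : ∀ i : Fin k, initSt k l b (.inp (0 + 1 + i)) = some (b i) := by
    intro i
    simp [initSt, add_comm 1]
  obtain ⟨n, q, hn, hq⟩ := decisionTree_reaches k 0 F b _ hs [] []
  simp only [List.nil_append, List.append_nil, List.length_nil, zero_add] at hn hq
  constructor
  · intro r hr
    refine ⟨n + 1, initSt k l b, ?_⟩
    rw [run, Function.iterate_succ_apply', hn]
    rw [hr] at hq
    cases r <;> simp [step, hq, outcomeInstr]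
  · rintro hF r ⟨m, s', hm⟩
    rw [hF] at hq
    have hstuck : (step (decisionTree k 0 F))^[m + n] (.running 1 (initSt k l b)) =
        .running (q + 1) (initSt k l b) := by
      rw [Function.iterate_add_apply, hn]
      exact Function.iterate_fixed (step_fjmp hq) m
    have hhalt : (step (decisionTree k 0 F))^[m + n] (.running 1 (initSt k l b)) =
        .terminated r s' := by
      rw [run] at hm
      rw [add_comm, Function.iterate_add_apply, hm]
      exact Function.iterate_fixed rfl n
    rw [hstuck] at hhalt
    cases hhalt

/-- Every partial function `F : Bool^k ⇀ Bool` is computed by a loop-free instruction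
sequence of length exactly `3·2^k − 2` that contains no backward jump and refers to no
auxiliary register, using 0 auxiliary registers. -/
theorem statement0 (k : ℕ) (F : (Fin k → Bool) → Option Bool) :
    ∃ I : List Instr, I ≠ [] ∧ LoopFree I ∧ (∀ u ∈ I, ¬ UsesAux u) ∧
      I.length = 3 * 2 ^ k - 2 ∧ Computes I k 0 F := by
  refine ⟨decisionTree k 0 F, ?_, ?_, ?_, length_decisionTree k 0 F,
    computes_decisionTree k 0 F⟩
  · cases k <;> simp [decisionTree]
  · intro l hl
    simpa using mem_decisionTree hl
  · intro u hu
    rcases mem_decisionTree hu with ⟨i, rfl⟩ | ⟨l, rfl⟩ | rfl | rfl <;> simp [UsesAux]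
end

section
/- Let k ≥ 1 and let C be a Boolean circuit over k inputs with n gates computing the total function F : Bool^k → Bool. Then there exists a loop-free instruction sequence of the form I; +aux:j.get; !t; !f for some j with 1 ≤ j ≤ n, where I is loop-free, length(I) ≤ 4n (so the whole sequence has length at most 4n + 3), and this instruction sequence computes F using n auxiliary registers. -/
/-- An argument of a gate: an input `x_j` or an earlier gate `g_m` (both 1-based). -/
inductive GateArg
  | input (j : ℕ)
  | gate (m : ℕ)

/-- A gate of a Boolean circuit. -/
inductive Gate
  | not (p : GateArg)
  | and (p q : GateArg)
  | or (p q : GateArg)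

/-- The value of a gate argument, given the input vector `b` and the list `vals` of
values of the earlier gates. -/
def argVal (k : ℕ) (b : Fin k → Bool) (vals : List Bool) : GateArg → Bool
  | .input j => if h : 1 ≤ j ∧ j ≤ k then b ⟨j - 1, by omega⟩ else false
  | .gate m => vals.getD (m - 1) false

/-- The value of a gate, given the input vector and the values of the earlier gates. -/
def gateVal (k : ℕ) (b : Fin k → Bool) (vals : List Bool) : Gate → Bool
  | .not p => ! argVal k b vals p
  | .and p q => argVal k b vals p && argVal k b vals q
  | .or p q => argVal k b vals p || argVal k b vals q

/-- The list of values of all gates of the circuit `C` on input `b`. -/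
def evalCircuit (k : ℕ) (b : Fin k → Bool) (C : List Gate) : List Bool :=
  C.foldl (fun vals g => vals ++ [gateVal k b vals g]) []

/-- The output of the circuit `C` on input `b`: the value of its last gate. -/
def circuitVal (k : ℕ) (b : Fin k → Bool) (C : List Gate) : Bool :=
  (evalCircuit k b C).getLast?.getD false

/-- Well-formedness of a gate argument occurring in the gate with (1-based) index `idx`
of a circuit over `k` inputs: it refers to an input `x_j` with `1 ≤ j ≤ k` or to an
earlier gate. -/
def ArgWF (k idx : ℕ) : GateArg → Prop
  | .input j => 1 ≤ j ∧ j ≤ k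
  | .gate m => 1 ≤ m ∧ m < idx

/-- Well-formedness of the gate with (1-based) index `idx`. -/
def GateWF (k idx : ℕ) : Gate → Prop
  | .not p => ArgWF k idx p
  | .and p q => ArgWF k idx p ∧ ArgWF k idx q
  | .or p q => ArgWF k idx p ∧ ArgWF k idx q

/-- A well-formed Boolean circuit over `k` inputs: a nonempty list of well-formed gates. -/
def CircuitWF (k : ℕ) (C : List Gate) : Prop :=
  C ≠ [] ∧ ∀ (idx : ℕ) (g : Gate), C[idx]? = some g → GateWF k (idx + 1) g

/-- The register holding the value of a gate argument. -/
def GateArg.focus : GateArg → Focus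
  | .input j => .inp j
  | .gate m => .aux m

/-- Code storing the value of a gate in `aux:i`, provided that `aux:i` holds `t` beforehand. -/
def Gate.code (i : ℕ) : Gate → List Instr
  | .not p => [.pos p.focus .get, .basic (.aux i) .setF]
  | .and p q => [.pos p.focus .get, .neg q.focus .get, .basic (.aux i) .setF]
  | .or p q => [.pos p.focus .get, .fjmp 3, .neg q.focus .get, .basic (.aux i) .setF]

/-- Code evaluating the given gates in order, storing their values in `aux:i`, `aux:(i+1)`, … -/
def gatesCode : ℕ → List Gate → List Instr
  | _, [] => []
  | i, g :: gs => g.code i ++ gatesCode (i + 1) gs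

theorem Gate.length_code_le (i : ℕ) (g : Gate) : (g.code i).length ≤ 4 := by
  cases g <;> simp [Gate.code]

theorem Gate.loopFree_code (i : ℕ) (g : Gate) : LoopFree (g.code i) := by
  intro l
  cases g <;> simp [Gate.code]

theorem length_gatesCode_le (i : ℕ) (gs : List Gate) :
    (gatesCode i gs).length ≤ 4 * gs.length := by
  induction gs generalizing i with
  | nil => simp [gatesCode]
  | cons g gs ih =>
    have h := g.length_code_le i
    have h' := ih (i + 1)
    simp only [gatesCode, List.length_append, List.length_cons]
    omega

theorem loopFree_gatesCode (i : ℕ) (gs : List Gate) : LoopFree (gatesCode i gs) := by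
  induction gs generalizing i with
  | nil => simp [gatesCode, LoopFree]
  | cons g gs ih =>
    intro l
    simp only [gatesCode, List.mem_append, not_or]
    exact ⟨g.loopFree_code i l, ih (i + 1) l⟩

/-- Configuration `c'` is reached from `c` after finitely many steps of `I`. -/
def Reaches (I : List Instr) (c c' : Config) : Prop := ∃ n, (step I)^[n] c = c'

theorem Reaches.refl (I : List Instr) (c : Config) : Reaches I c c := ⟨0, rfl⟩

theorem Reaches.trans {I : List Instr} {c₁ c₂ c₃ : Config} (h₁ : Reaches I c₁ c₂)
    (h₂ : Reaches I c₂ c₃) : Reaches I c₁ c₃ := by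
  obtain ⟨m, rfl⟩ := h₁
  obtain ⟨n, rfl⟩ := h₂
  exact ⟨n + m, Function.iterate_add_apply _ _ _ _⟩

theorem Reaches.single {I : List Instr} {c c' : Config} (h : step I c = c') : Reaches I c c' :=
  ⟨1, h⟩

section Steps

variable {I : List Instr} {i : ℕ} {s : St} {f : Focus} {v : Bool}

theorem reaches_pos_get (hI : I[i]? = some (.pos f .get)) (hs : s f = some v) :
    Reaches I (.running (i + 1) s) (.running (i + (if v then 2 else 3)) s) := by
  apply Reaches.single
  cases v <;> simp [step, hI, hs, procReply, updSt_get]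

theorem reaches_neg_get (hI : I[i]? = some (.neg f .get)) (hs : s f = some v) :
    Reaches I (.running (i + 1) s) (.running (i + (if v then 3 else 2)) s) := by
  apply Reaches.single
  cases v <;> simp [step, hI, hs, procReply, updSt_get]

theorem reaches_fjmp {l : ℕ} (hI : I[i]? = some (.fjmp l)) :
    Reaches I (.running (i + 1) s) (.running (i + 1 + l) s) := by
  apply Reaches.single
  simp [step, hI]

theorem reaches_setF (hI : I[i]? = some (.basic f .setF)) (hs : s f = some v) :
    Reaches I (.running (i + 1) s) (.running (i + 2) (updSt s f .setF)) := by
  apply Reaches.single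
  simp [step, hI, hs, procReply]

end Steps

/-- The registers of `s` hold the inputs `b` and the values `vals` of the gates evaluated so far,
and the registers of the remaining gates (up to `n`) still hold `t`. -/
structure Represents (k n : ℕ) (b : Fin k → Bool) (vals : List Bool) (s : St) : Prop where
  arg : ∀ a, ArgWF k (vals.length + 1) a → s a.focus = some (argVal k b vals a)
  rest : ∀ m, vals.length < m → m ≤ n → s (.aux m) = some true

theorem represents_initSt (k n : ℕ) (b : Fin k → Bool) :
    Represents k n b [] (initSt k n b) where
  arg a ha := by
    cases a with
    | input j =>
      simp only [ArgWF] at ha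
      simp [GateArg.focus, initSt, argVal, ha]
    | gate m =>
      simp only [ArgWF, List.length_nil] at ha
      omega
  rest m hm hn := by
    simp only [List.length_nil] at hm
    simp [initSt, hn, Nat.one_le_iff_ne_zero, hm.ne']

theorem Represents.append {k n : ℕ} {b : Fin k → Bool} {vals : List Bool} {s s' : St}
    (h : Represents k n b vals s) {v : Bool}
    (hv : s' (.aux (vals.length + 1)) = some v)
    (hs : ∀ f, f ≠ .aux (vals.length + 1) → s' f = s f) :
    Represents k n b (vals ++ [v]) s' where
  arg a ha := by
    cases a with
    | input j =>
      rw [hs _ (by simp [GateArg.focus]), h.arg _ (by exact ha)]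
      rfl
    | gate m =>
      simp only [ArgWF, List.length_append, List.length_singleton] at ha
      by_cases hm : m = vals.length + 1
      · subst hm
        simp [GateArg.focus, hv, argVal]
      · rw [hs _ (by simpa [GateArg.focus] using hm), h.arg (.gate m) ⟨ha.1, by omega⟩]
        simp only [argVal]
        rw [List.getD_append _ _ _ _ (by omega)]
  rest m hm hn := by
    simp only [List.length_append, List.length_singleton] at hm
    rw [hs _ (by simp; omega), h.rest m (by omega) hn]

theorem Represents.append_true {k n : ℕ} {b : Fin k → Bool} {vals : List Bool} {s : St}
    (h : Represents k n b vals s) (hn : vals.length < n) :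
    Represents k n b (vals ++ [true]) s :=
  h.append (h.rest _ (Nat.lt_succ_self _) hn) fun _ _ => rfl

theorem Represents.append_false {k n : ℕ} {b : Fin k → Bool} {vals : List Bool} {s : St}
    (h : Represents k n b vals s) (hn : vals.length < n) :
    Represents k n b (vals ++ [false]) (updSt s (.aux (vals.length + 1)) .setF) :=
  h.append (by simp [updSt, h.rest _ (Nat.lt_succ_self _) hn, procEff])
    fun f hf => by simp [updSt, hf]

theorem reaches_gate_code {k n : ℕ} {b : Fin k → Bool} {vals : List Bool} {s : St}
    (h : Represents k n b vals s) (hn : vals.length < n) {g : Gate}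
    (hg : GateWF k (vals.length + 1) g) (pre post : List Instr) :
    ∃ s', Represents k n b (vals ++ [gateVal k b vals g]) s' ∧
      Reaches (pre ++ (g.code (vals.length + 1) ++ post)) (.running (pre.length + 1) s)
        (.running (pre.length + (g.code (vals.length + 1)).length + 1) s') := by
  have haux := h.rest _ (Nat.lt_succ_self _) hn
  have ht := h.append_true hn
  have hf := h.append_false hn
  cases g with
  | not p =>
    have hp := h.arg p hg
    set I := pre ++ ((Gate.not p).code (vals.length + 1) ++ post) with hI
    have h0 : I[pre.length]? = some (.pos p.focus .get) := by simp [hI, Gate.code]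
    have h1 : I[pre.length + 1]? = some (.basic (.aux (vals.length + 1)) .setF) := by
      simp [hI, Gate.code]
    have r0 := reaches_pos_get h0 hp
    have r1 := reaches_setF h1 haux
    simp only [gateVal]
    cases hpv : argVal k b vals p <;> simp only [hpv] at r0
    · exact ⟨s, ht, r0⟩
    · exact ⟨_, hf, r0.trans r1⟩
  | and p q =>
    have hp := h.arg p hg.1
    have hq := h.arg q hg.2
    set I := pre ++ ((Gate.and p q).code (vals.length + 1) ++ post) with hI
    have h0 : I[pre.length]? = some (.pos p.focus .get) := by simp [hI, Gate.code]
    have h1 : I[pre.length + 1]? = some (.neg q.focus .get) := by simp [hI, Gate.code]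
    have h2 : I[pre.length + 2]? = some (.basic (.aux (vals.length + 1)) .setF) := by
      simp [hI, Gate.code]
    have r0 := reaches_pos_get h0 hp
    have r1 := reaches_neg_get h1 hq
    have r2 := reaches_setF h2 haux
    simp only [gateVal]
    cases hpv : argVal k b vals p <;> simp only [hpv] at r0
    · exact ⟨_, hf, r0.trans r2⟩
    · cases hqv : argVal k b vals q <;> simp only [hqv] at r1
      · exact ⟨_, hf, r0.trans (r1.trans r2)⟩
      · exact ⟨s, ht, r0.trans r1⟩
  | or p q =>
    have hp := h.arg p hg.1
    have hq := h.arg q hg.2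
    set I := pre ++ ((Gate.or p q).code (vals.length + 1) ++ post) with hI
    have h0 : I[pre.length]? = some (.pos p.focus .get) := by simp [hI, Gate.code]
    have h1 : I[pre.length + 1]? = some (.fjmp 3) := by simp [hI, Gate.code]
    have h2 : I[pre.length + 2]? = some (.neg q.focus .get) := by simp [hI, Gate.code]
    have h3 : I[pre.length + 3]? = some (.basic (.aux (vals.length + 1)) .setF) := by
      simp [hI, Gate.code]
    have r0 := reaches_pos_get h0 hp
    have r1 := reaches_fjmp (s := s) h1
    have r2 := reaches_neg_get h2 hq
    have r3 := reaches_setF h3 haux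
    simp only [gateVal]
    cases hpv : argVal k b vals p <;> simp only [hpv] at r0
    · cases hqv : argVal k b vals q <;> simp only [hqv] at r2
      · exact ⟨_, hf, r0.trans (r2.trans r3)⟩
      · exact ⟨s, ht, r0.trans r2⟩
    · exact ⟨s, ht, r0.trans r1⟩

theorem reaches_gatesCode {k n : ℕ} {b : Fin k → Bool} (gs : List Gate) {vals : List Bool} {s : St}
    (h : Represents k n b vals s) (hn : vals.length + gs.length ≤ n)
    (hg : ∀ i g, gs[i]? = some g → GateWF k (vals.length + i + 1) g) (pre post : List Instr) :
    ∃ s', Represents k n b (gs.foldl (fun vals g => vals ++ [gateVal k b vals g]) vals) s' ∧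
      Reaches (pre ++ (gatesCode (vals.length + 1) gs ++ post)) (.running (pre.length + 1) s)
        (.running (pre.length + (gatesCode (vals.length + 1) gs).length + 1) s') := by
  induction gs generalizing vals s pre with
  | nil => exact ⟨s, h, Reaches.refl _ _⟩
  | cons g gs ih =>
    rw [List.length_cons] at hn
    obtain ⟨s₁, h₁, r₁⟩ := reaches_gate_code h (by omega) (hg 0 g rfl) pre
      (gatesCode (vals.length + 1 + 1) gs ++ post)
    obtain ⟨s₂, h₂, r₂⟩ := ih h₁ (by simp; omega)
      (fun i g' hi => by
        have := hg (i + 1) g' (by simpa using hi)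
        simpa [Nat.add_assoc, Nat.add_comm, Nat.add_left_comm] using this)
      (pre ++ g.code (vals.length + 1))
    refine ⟨s₂, h₂, ?_⟩
    simp only [List.length_append, List.length_singleton, List.append_assoc] at r₂
    simpa [gatesCode, Nat.add_assoc] using r₁.trans r₂

theorem length_evalCircuit (k : ℕ) (b : Fin k → Bool) (C : List Gate) :
    (evalCircuit k b C).length = C.length := by
  induction C using List.reverseRecOn with
  | nil => rfl
  | append_singleton C g ih =>
    simp only [evalCircuit] at ih
    simp [evalCircuit, ih]

theorem termWith_of_reaches_output {I : List Instr} {j : ℕ} {s s' : St} {r : Bool}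
    (h : Reaches (I ++ [.pos (.aux j) .get, .termT, .termF]) (.running 1 s)
      (.running (I.length + 1) s')) (hs : s' (.aux j) = some r) :
    TermWith (I ++ [.pos (.aux j) .get, .termT, .termF]) s r := by
  have r₁ := reaches_pos_get
    (I := I ++ [.pos (.aux j) .get, .termT, .termF]) (i := I.length) (by simp) hs
  have r₂ : Reaches (I ++ [.pos (.aux j) .get, .termT, .termF])
      (.running (I.length + (if r then 2 else 3)) s') (.terminated r s') := by
    apply Reaches.single
    cases r <;> simp [step]
  obtain ⟨m, hm⟩ := (h.trans r₁).trans r₂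
  exact ⟨m, s', hm⟩


/-- Every total function `F : Bool^k → Bool` computed by a Boolean circuit with `n`
gates is computed, using `n` auxiliary registers, by a loop-free instruction sequence
of the form `I; +aux:j.get; !t; !f` with `1 ≤ j ≤ n`, `I` loop-free and
`length(I) ≤ 4n` (so the whole sequence has length at most `4n + 3`). -/
theorem statement4 (k : ℕ) (hk : 1 ≤ k) (C : List Gate) (hC : CircuitWF k C)
    (F : (Fin k → Bool) → Bool) (hF : ∀ b, circuitVal k b C = F b) :
    ∃ (I : List Instr) (j : ℕ), 1 ≤ j ∧ j ≤ C.length ∧ LoopFree I ∧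
      I.length ≤ 4 * C.length ∧
      (I ++ [Instr.pos (.aux j) .get, Instr.termT, Instr.termF]).length
        ≤ 4 * C.length + 3 ∧
      Computes (I ++ [Instr.pos (.aux j) .get, Instr.termT, Instr.termF]) k C.length
        (fun b => some (F b)) := by
  have hpos : 1 ≤ C.length := List.length_pos_iff.mpr hC.1
  have hlen := length_gatesCode_le 1 C
  refine ⟨gatesCode 1 C, C.length, hpos, le_rfl, loopFree_gatesCode 1 C, hlen, by simpa using hlen,
    fun b => ⟨fun r hr => ?_, by simp⟩⟩
  obtain rfl : F b = r := by simpa using hr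
  obtain ⟨s', h, hr⟩ := reaches_gatesCode C (represents_initSt k C.length b) (by simp)
    (fun i g hi => by simpa using hC.2 i g hi) []
    [.pos (.aux C.length) .get, .termT, .termF]
  change Represents k C.length b (evalCircuit k b C) s' at h
  refine termWith_of_reaches_output (s' := s') (by simpa using hr) ?_
  have hout := h.arg (.gate C.length) ⟨hpos, by rw [length_evalCircuit]; omega⟩
  rw [← hF b, circuitVal, List.getLast?_eq_getElem?, length_evalCircuit]
  simpa [GateArg.focus, argVal, List.getD_eq_getElem?_getD] using hout
end

section
/- For every k ≥ 1 and every bijection φ : {1,…,8k^3} → {1,…,k}^3 × {1,…,8}, the instruction sequence I_k = CHECK; NEXT; \#(72k^3 + 5k), which has length 72k^3 + 5k + 1 and contains a backward jump, computes the total function 3SAT(k) : Bool^{8k^3} → Bool using k auxiliary registers. In particular, for every k ≥ 1 the function 3SAT(k) is computed by an instruction sequence whose length is bounded by a polynomial in the number 8k^3 of its inputs (i.e., 3SAT ∈ IS_P). -/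
/-- `posTest true f = +f.get` and `posTest false f = -f.get`. -/
def polTest (pb : Bool) (f : Focus) : Instr :=
  if pb then .pos f .get else .neg f .get

/-- Sign of the first literal of the clause `γ_(l,m,n,i)`: positive iff `i ∈ {1,2,3,4}`. -/
def sgn1 (i : ℕ) : Bool := decide (i ≤ 4)

/-- Sign of the second literal of `γ_(l,m,n,i)`: positive iff `i ∈ {1,2,5,6}`. -/
def sgn2 (i : ℕ) : Bool := decide (i = 1 ∨ i = 2 ∨ i = 5 ∨ i = 6)

/-- Sign of the third literal of `γ_(l,m,n,i)`: positive iff `i` is odd. -/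
def sgn3 (i : ℕ) : Bool := decide (i % 2 = 1)

/-- The assignment `a` satisfies the 3-clause `γ_(l,m,n,i)`,
i.e. makes at least one of its three literals true. -/
def SatClause (a : ℕ → Bool) : ℕ × ℕ × ℕ × ℕ → Prop
  | (l, m, n, i) => a l = sgn1 i ∨ a m = sgn2 i ∨ a n = sgn3 i

/-- `CHECK_(l,m,n,i) = T₁ aux:l.get; #2; T₂ aux:m.get; #2; T₃ aux:n.get`. -/
def CHECKc : ℕ × ℕ × ℕ × ℕ → List Instr
  | (l, m, n, i) =>
    [polTest (sgn1 i) (.aux l), .fjmp 2, polTest (sgn2 i) (.aux m), .fjmp 2,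
     polTest (sgn3 i) (.aux n)]

/-- The `m`-th guarded check (for a total of `K` clauses):
`-in:m.get; #8; CHECK_{φ(m)}; #2; #9` if `m < K`, and
`-in:K.get; #6; CHECK_{φ(K)}; !t` if `m = K`. -/
def guarded (K : ℕ) (φ : ℕ → ℕ × ℕ × ℕ × ℕ) (m : ℕ) : List Instr :=
  if m < K then
    [.neg (.inp m) .get, .fjmp 8] ++ CHECKc (φ m) ++ [.fjmp 2, .fjmp 9]
  else
    [.neg (.inp m) .get, .fjmp 6] ++ CHECKc (φ m) ++ [.termT]

/-- `CHECK`: the concatenation of the guarded checks for `m = 1, …, 8k³`. -/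
def CHECKseq (k : ℕ) (φ : ℕ → ℕ × ℕ × ℕ × ℕ) : List Instr :=
  (List.range (8 * k ^ 3)).flatMap fun j => guarded (8 * k ^ 3) φ (j + 1)

/-- `NEXT_i = -aux:i.get; #3; aux:i.set:f; #5; aux:i.set:t` (for `1 ≤ i < k`). -/
def NEXTi (i : ℕ) : List Instr :=
  [.neg (.aux i) .get, .fjmp 3, .basic (.aux i) .setF, .fjmp 5, .basic (.aux i) .setT]

/-- `NEXT_k = -aux:k.get; #3; aux:k.set:f; #3; aux:k.set:t; !f`. -/
def NEXTlast (k : ℕ) : List Instr :=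
  [.neg (.aux k) .get, .fjmp 3, .basic (.aux k) .setF, .fjmp 3, .basic (.aux k) .setT,
   .termF]

/-- `NEXT = NEXT_1; … ; NEXT_{k-1}; NEXT_k`, the assignment generator of length `5k + 1`. -/
def NEXT (k : ℕ) : List Instr :=
  (List.range (k - 1)).flatMap (fun i => NEXTi (i + 1)) ++ NEXTlast k

/-- The 3-CNF encoded by the Boolean sequence `b` of length `8k³` (clause `γ_{φ(m)}`
is present iff the `m`-th entry of `b` is `t`) is satisfiable. -/
def SatFormula (k : ℕ) (φ : ℕ → ℕ × ℕ × ℕ × ℕ) (b : List Bool) : Prop :=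
  ∃ a : ℕ → Bool, ∀ m : ℕ, 1 ≤ m → m ≤ 8 * k ^ 3 →
    b.getD (m - 1) false = true → SatClause a (φ m)

attribute [local instance] Classical.propDecidable

/-- Configuration `c'` is reached from `c` after finitely many steps of `I`. -/
def Reach (I : List Instr) (c c' : Config) : Prop := ∃ n, (step I)^[n] c = c'

/-- The block `L` occurs in `I` at the (0-based) offset `p`. -/
def BlockAt (I : List Instr) (p : ℕ) (L : List Instr) : Prop :=
  ∀ i u, L[i]? = some u → I[p + i]? = some u

/-- The state in which the inputs hold `b` and the auxiliary registers `1, …, k` hold `a`. -/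
def assignSt {K : ℕ} (k : ℕ) (b : Fin K → Bool) (a : ℕ → Bool) : St
  | .inp i => initSt K k b (.inp i)
  | .aux j => if 1 ≤ j ∧ j ≤ k then some (a j) else none

/-- The clauses selected by `b` are all satisfied by `a`. -/
def SatAll (K : ℕ) (φ : ℕ → ℕ × ℕ × ℕ × ℕ) (b : Fin K → Bool) (a : ℕ → Bool) : Prop :=
  ∀ j : Fin K, b j = true → SatClause a (φ (j + 1))

namespace Reach

variable {I : List Instr} {c c' c'' : Config} {p : ℕ} {s : St}

theorem trans (h : Reach I c c') (h' : Reach I c' c'') : Reach I c c'' := by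
  obtain ⟨n, rfl⟩ := h
  obtain ⟨m, rfl⟩ := h'
  exact ⟨m + n, Function.iterate_add_apply _ _ _ _⟩

theorem of_step (h : step I c = c') : Reach I c c' := ⟨1, h⟩

theorem fjmp {l : ℕ} (h : I[p]? = some (.fjmp l)) :
    Reach I (.running (p + 1) s) (.running (p + 1 + l) s) :=
  of_step (by simp [step, h])

theorem bjmp {l : ℕ} (h : I[p]? = some (.bjmp l)) (hl : l ≤ p) :
    Reach I (.running (p + 1) s) (.running (p + 1 - l) s) :=
  of_step (by simp [step, h, Nat.lt_succ_of_le hl])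

theorem termT (h : I[p]? = some .termT) :
    Reach I (.running (p + 1) s) (.terminated true s) :=
  of_step (by simp [step, h])

theorem termF (h : I[p]? = some .termF) :
    Reach I (.running (p + 1) s) (.terminated false s) :=
  of_step (by simp [step, h])

theorem basic {f : Focus} {m : Method} {x : Bool} (h : I[p]? = some (.basic f m))
    (hs : s f = some x) :
    Reach I (.running (p + 1) s) (.running (p + 2) (updSt s f m)) :=
  of_step (by cases m <;> simp [step, h, hs, procReply])

theorem _root_.updSt_get_s8 (s : St) (f : Focus) : updSt s f .get = s := by
  funext g
  by_cases hg : g = f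
  · subst hg
    cases hs : s g <;> simp [updSt, procEff, hs]
  · simp [updSt, hg]

theorem test_pass {f : Focus} {x : Bool} (h : I[p]? = some (polTest x f))
    (hs : s f = some x) : Reach I (.running (p + 1) s) (.running (p + 2) s) :=
  of_step (by cases x <;> simp_all [step, polTest, procReply, updSt_get_s8])

theorem test_fail {f : Focus} {x y : Bool} (h : I[p]? = some (polTest x f))
    (hs : s f = some y) (hxy : y ≠ x) :
    Reach I (.running (p + 1) s) (.running (p + 3) s) :=
  of_step (by cases x <;> cases y <;> simp_all [step, polTest, procReply, updSt_get_s8])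

end Reach

theorem Reach.termWith {I : List Instr} {s s' : St} {r : Bool}
    (h : Reach I (.running 1 s) (.terminated r s')) : TermWith I s r := by
  obtain ⟨n, hn⟩ := h
  exact ⟨n, s', hn⟩

section Blocks

variable {I L L' : List Instr} {p : ℕ}

theorem BlockAt.mono_left (h : BlockAt I p L) : BlockAt (I ++ L') p L := fun i u hu => by
  have := h i u hu
  rw [List.getElem?_append_left (List.getElem?_eq_some_iff.1 this).1, this]

theorem BlockAt.shift (h : BlockAt I p L) : BlockAt (L' ++ I) (L'.length + p) L :=
  fun i u hu => by
    rw [add_assoc, List.getElem?_append_right (by omega), Nat.add_sub_cancel_left]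
    exact h i u hu

theorem blockAt_self : BlockAt L 0 L := fun i u hu => by simpa using hu

theorem length_flatMap_range {α : Type*} (f : ℕ → List α) (c n : ℕ)
    (h : ∀ j < n, (f j).length = c) : ((List.range n).flatMap f).length = c * n := by
  induction n with
  | zero => simp
  | succ n ih =>
    rw [List.range_succ, List.flatMap_append, List.length_append,
      ih fun j hj => h j (by omega)]
    simp [h n (by omega), mul_add]

theorem blockAt_flatMap_range (f : ℕ → List Instr) (c n : ℕ)
    (h : ∀ j, j + 1 < n → (f j).length = c) {j : ℕ} (hj : j < n) :
    BlockAt ((List.range n).flatMap f) (c * j) (f j) := by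
  induction n with
  | zero => omega
  | succ n ih =>
    rw [List.range_succ, List.flatMap_append]
    rcases Nat.lt_succ_iff_lt_or_eq.1 hj with hlt | rfl
    · exact (ih (fun i hi => h i (by omega)) hlt).mono_left
    · have := (blockAt_self (L := f j)).shift (L' := (List.range j).flatMap f)
      rw [length_flatMap_range f c j fun i hi => h i (by omega)] at this
      simpa using this

end Blocks

section Execution

variable {I : List Instr} {p k K : ℕ} {φ : ℕ → ℕ × ℕ × ℕ × ℕ} {b : Fin K → Bool}
  {a : ℕ → Bool}

theorem assignSt_aux {j : ℕ} (h : 1 ≤ j ∧ j ≤ k) :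
    assignSt k b a (.aux j) = some (a j) := by simp [assignSt, h]

theorem assignSt_inp (j : Fin K) : assignSt k b a (.inp (j + 1)) = some (b j) := by
  simp [assignSt, initSt, Nat.succ_le_of_lt j.isLt]

theorem updSt_assignSt_setT {i : ℕ} (h : 1 ≤ i ∧ i ≤ k) :
    updSt (assignSt k b a) (.aux i) .setT = assignSt k b (Function.update a i true) := by
  funext g
  cases g with
  | inp j => simp [updSt, assignSt]
  | aux j =>
    by_cases hj : j = i
    · subst hj; simp [updSt, assignSt, h, procEff]
    · simp [updSt, assignSt, hj]

theorem updSt_assignSt_setF {i : ℕ} (h : 1 ≤ i ∧ i ≤ k) :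
    updSt (assignSt k b a) (.aux i) .setF = assignSt k b (Function.update a i false) := by
  funext g
  cases g with
  | inp j => simp [updSt, assignSt]
  | aux j =>
    by_cases hj : j = i
    · subst hj; simp [updSt, assignSt, h, procEff]
    · simp [updSt, assignSt, hj]

/-- Every variable index occurring in a clause `φ m`, `1 ≤ m ≤ K`, lies in `{1, …, k}`. -/
def VarsIn (k K : ℕ) (φ : ℕ → ℕ × ℕ × ℕ × ℕ) : Prop :=
  ∀ m, 1 ≤ m → m ≤ K → (1 ≤ (φ m).1 ∧ (φ m).1 ≤ k) ∧
    (1 ≤ (φ m).2.1 ∧ (φ m).2.1 ≤ k) ∧ (1 ≤ (φ m).2.2.1 ∧ (φ m).2.2.1 ≤ k)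

theorem SatClause.congr {a' : ℕ → Bool} (hφ : VarsIn k K φ)
    (h : ∀ i, 1 ≤ i → i ≤ k → a' i = a i) {m : ℕ} (h1 : 1 ≤ m) (hm : m ≤ K)
    (hs : SatClause a' (φ m)) : SatClause a (φ m) := by
  obtain ⟨hl, hm', hn⟩ := hφ m h1 hm
  simp only [SatClause] at hs ⊢
  rwa [h _ hl.1 hl.2, h _ hm'.1 hm'.2, h _ hn.1 hn.2] at hs

theorem reach_clause_pass {t : ℕ × ℕ × ℕ × ℕ} (hI : BlockAt I p (CHECKc t))
    (hl : 1 ≤ t.1 ∧ t.1 ≤ k) (hm : 1 ≤ t.2.1 ∧ t.2.1 ≤ k)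
    (hn : 1 ≤ t.2.2.1 ∧ t.2.2.1 ≤ k) (hs : SatClause a t) :
    Reach I (.running (p + 1) (assignSt k b a)) (.running (p + 6) (assignSt k b a)) := by
  obtain ⟨l, m, n, i⟩ := t
  have h0 := hI 0 _ rfl
  have h1 := hI 1 _ rfl
  have h2 := hI 2 _ rfl
  have h3 := hI 3 _ rfl
  have h4 := hI 4 _ rfl
  have e3 : Reach I (.running (p + 4) (assignSt k b a)) (.running (p + 6) (assignSt k b a)) :=
    Reach.fjmp h3
  by_cases c1 : a l = sgn1 i
  · exact ((Reach.test_pass h0 (by rw [assignSt_aux hl, c1])).trans (Reach.fjmp h1)).trans e3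
  refine (Reach.test_fail h0 (assignSt_aux hl) c1).trans ?_
  by_cases c2 : a m = sgn2 i
  · exact (Reach.test_pass h2 (by rw [assignSt_aux hm, c2])).trans e3
  refine (Reach.test_fail h2 (assignSt_aux hm) c2).trans ?_
  have c3 : a n = sgn3 i := (hs.resolve_left c1).resolve_left c2
  exact Reach.test_pass h4 (by rw [assignSt_aux hn, c3])

theorem reach_clause_fail {t : ℕ × ℕ × ℕ × ℕ} (hI : BlockAt I p (CHECKc t))
    (hl : 1 ≤ t.1 ∧ t.1 ≤ k) (hm : 1 ≤ t.2.1 ∧ t.2.1 ≤ k)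
    (hn : 1 ≤ t.2.2.1 ∧ t.2.2.1 ≤ k) (hs : ¬ SatClause a t) :
    Reach I (.running (p + 1) (assignSt k b a)) (.running (p + 7) (assignSt k b a)) := by
  obtain ⟨l, m, n, i⟩ := t
  obtain ⟨c1, c2, c3⟩ : a l ≠ sgn1 i ∧ a m ≠ sgn2 i ∧ a n ≠ sgn3 i := by
    simpa [SatClause] using hs
  exact ((Reach.test_fail (hI 0 _ rfl) (assignSt_aux hl) c1).trans
    (Reach.test_fail (hI 2 _ rfl) (assignSt_aux hm) c2)).trans
    (Reach.test_fail (hI 4 _ rfl) (assignSt_aux hn) c3)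

theorem clauseBlock_of_guarded {m : ℕ} (h : BlockAt I p (guarded K φ m)) :
    BlockAt I (p + 2) (CHECKc (φ m)) := by
  intro i u hu
  have hi := (List.getElem?_eq_some_iff.1 hu).1
  rw [add_assoc]
  refine h _ _ ?_
  unfold guarded
  split_ifs
  all_goals
    rw [List.getElem?_append_left (by simp; omega), List.getElem?_append_right (by simp)]
    simpa using hu

theorem guarded_getElem_zero (m : ℕ) :
    (guarded K φ m)[0]? = some (polTest false (.inp m)) := by
  unfold guarded
  split_ifs <;> rfl

/-- A guarded check whose clause is absent or satisfied passes control to the next one, or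
terminates with reply `t` if it is the last one. -/
theorem reach_guarded_pass (hφ : VarsIn k K φ) (j : Fin K)
    (hI : BlockAt I p (guarded K φ (j + 1))) (hs : b j = true → SatClause a (φ (j + 1))) :
    ((j : ℕ) + 1 < K → Reach I (.running (p + 1) (assignSt k b a))
      (.running (p + 10) (assignSt k b a))) ∧
    ((j : ℕ) + 1 = K → Reach I (.running (p + 1) (assignSt k b a))
      (.terminated true (assignSt k b a))) := by
  have h0 := hI 0 _ (guarded_getElem_zero _)
  obtain ⟨hl, hm, hn⟩ := hφ (j + 1) (by omega) (by omega)
  have hc := clauseBlock_of_guarded hI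
  constructor
  · intro hj
    have h1 := hI 1 (.fjmp 8) (by simp [guarded, hj])
    have h7 := hI 7 (.fjmp 2) (by simp [guarded, hj, CHECKc])
    by_cases hb : b j = true
    · exact ((Reach.test_fail h0 (assignSt_inp j) (by simp [hb])).trans
        (reach_clause_pass hc hl hm hn (hs hb))).trans (Reach.fjmp h7)
    · exact (Reach.test_pass h0 (by simp [assignSt_inp, hb])).trans (Reach.fjmp h1)
  · intro hj
    have h1 := hI 1 (.fjmp 6) (by simp [guarded, hj])
    have h7 := hI 7 .termT (by simp [guarded, hj, CHECKc])
    by_cases hb : b j = true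
    · exact ((Reach.test_fail h0 (assignSt_inp j) (by simp [hb])).trans
        (reach_clause_pass hc hl hm hn (hs hb))).trans (Reach.termT h7)
    · exact ((Reach.test_pass h0 (by simp [assignSt_inp, hb])).trans (Reach.fjmp h1)).trans
        (Reach.termT h7)

theorem reach_guarded_fail (hφ : VarsIn k K φ) (j : Fin K)
    (hI : BlockAt I p (guarded K φ (j + 1))) (hb : b j = true)
    (hs : ¬ SatClause a (φ (j + 1))) :
    Reach I (.running (p + 1) (assignSt k b a)) (.running (p + 9) (assignSt k b a)) := by
  obtain ⟨hl, hm, hn⟩ := hφ (j + 1) (by omega) (by omega)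
  exact (Reach.test_fail (hI 0 _ (guarded_getElem_zero _)) (assignSt_inp j) (by simp [hb])).trans
    (reach_clause_fail (clauseBlock_of_guarded hI) hl hm hn hs)

theorem reach_guarded_exit (hI : ∀ j < K, BlockAt I (9 * j) (guarded K φ (j + 1))) (s : St)
    {j : ℕ} (hj : j < K) : Reach I (.running (9 * j + 9) s) (.running (9 * K) s) := by
  obtain ⟨d, hd⟩ := Nat.exists_eq_add_of_lt hj
  induction d generalizing j with
  | zero => exact ⟨0, by simp [hd]; omega⟩
  | succ d ih =>
    have h8 := hI j hj 8 (.fjmp 9) (by simp [guarded, CHECKc, show j + 1 < K by omega])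
    exact (Reach.fjmp h8).trans (ih (j := j + 1) (by omega) (by omega))

theorem reach_check (hφ : VarsIn k K φ)
    (hI : ∀ j < K, BlockAt I (9 * j) (guarded K φ (j + 1))) {j : ℕ} (hj : j < K) :
    ((∀ i : Fin K, j ≤ i → b i = true → SatClause a (φ (i + 1))) ∧
      Reach I (.running (9 * j + 1) (assignSt k b a)) (.terminated true (assignSt k b a))) ∨
    ((∃ i : Fin K, b i = true ∧ ¬ SatClause a (φ (i + 1))) ∧
      Reach I (.running (9 * j + 1) (assignSt k b a)) (.running (9 * K) (assignSt k b a))) := by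
  obtain ⟨d, hd⟩ := Nat.exists_eq_add_of_lt hj
  induction d generalizing j with
  | zero =>
    by_cases hs : b ⟨j, hj⟩ = true → SatClause a (φ (j + 1))
    · refine .inl ⟨fun i hi => ?_, (reach_guarded_pass hφ ⟨j, hj⟩ (hI j hj) hs).2 hd.symm⟩
      obtain rfl : i = ⟨j, hj⟩ := Fin.ext (by simp; omega)
      exact hs
    · rw [Classical.not_imp] at hs
      exact .inr ⟨⟨_, hs⟩, (reach_guarded_fail hφ ⟨j, hj⟩ (hI j hj) hs.1 hs.2).trans
        (reach_guarded_exit hI _ hj)⟩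
  | succ d ih =>
    by_cases hs : b ⟨j, hj⟩ = true → SatClause a (φ (j + 1))
    · have hr := (reach_guarded_pass (b := b) (a := a) hφ ⟨j, hj⟩ (hI j hj) hs).1
        (by simp; omega)
      rcases ih (j := j + 1) (by omega) (by omega) with ⟨h, h'⟩ | ⟨h, h'⟩
      · refine .inl ⟨fun i hi => ?_, hr.trans h'⟩
        rcases Nat.eq_or_lt_of_le hi with he | hlt
        · obtain rfl : i = ⟨j, hj⟩ := Fin.ext he.symm
          exact hs
        · exact h i hlt
      · exact .inr ⟨h, hr.trans h'⟩
    · rw [Classical.not_imp] at hs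
      exact .inr ⟨⟨_, hs⟩, (reach_guarded_fail hφ ⟨j, hj⟩ (hI j hj) hs.1 hs.2).trans
        (reach_guarded_exit hI _ hj)⟩

/-- The block of `NEXT` treating the auxiliary register `j + 1`. -/
def nextBlock (k j : ℕ) : List Instr := if j + 1 < k then NEXTi (j + 1) else NEXTlast (j + 1)

theorem reach_next_exit {B : ℕ} (hI : ∀ j < k, BlockAt I (B + 5 * j) (nextBlock k j)) (s : St)
    {j : ℕ} (hj : j < k) :
    Reach I (.running (B + 5 * j + 4) s) (.running (B + 5 * k + 2) s) := by
  obtain ⟨d, hd⟩ := Nat.exists_eq_add_of_lt hj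
  induction d generalizing j with
  | zero =>
    have h3 := hI j hj 3 (.fjmp 3) (by simp [nextBlock, NEXTlast, show ¬ j + 1 < k by omega])
    convert Reach.fjmp h3 using 2
    omega
  | succ d ih =>
    have h3 := hI j hj 3 (.fjmp 5) (by simp [nextBlock, NEXTi, show j + 1 < k by omega])
    exact (Reach.fjmp h3).trans (ih (j := j + 1) (by omega) (by omega))

theorem reach_next_true {B : ℕ} (hI : ∀ j < k, BlockAt I (B + 5 * j) (nextBlock k j))
    {j : ℕ} (hj : j < k) (ha : a (j + 1) = true) :
    Reach I (.running (B + 5 * j + 1) (assignSt k b a))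
      (.running (B + 5 * k + 2) (assignSt k b (Function.update a (j + 1) false))) := by
  have hr : 1 ≤ j + 1 ∧ j + 1 ≤ k := by omega
  have h0 := hI j hj 0 (polTest false (.aux (j + 1)))
    (by unfold nextBlock; split_ifs <;> rfl)
  have h2 := hI j hj 2 (.basic (.aux (j + 1)) .setF)
    (by unfold nextBlock; split_ifs <;> rfl)
  have e := Reach.basic h2 (assignSt_aux (b := b) (a := a) hr)
  rw [updSt_assignSt_setF hr] at e
  exact ((Reach.test_fail h0 (assignSt_aux hr) (by simp [ha])).trans e).trans
    (reach_next_exit hI _ hj)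

theorem reach_next_false {B : ℕ} (hI : ∀ j < k, BlockAt I (B + 5 * j) (nextBlock k j))
    {j : ℕ} (hj : j < k) (ha : a (j + 1) = false) :
    Reach I (.running (B + 5 * j + 1) (assignSt k b a))
      (.running (B + 5 * (j + 1) + 1)
        (assignSt k b (Function.update a (j + 1) true))) := by
  have hr : 1 ≤ j + 1 ∧ j + 1 ≤ k := by omega
  have h0 := hI j hj 0 (polTest false (.aux (j + 1)))
    (by unfold nextBlock; split_ifs <;> rfl)
  have h1 := hI j hj 1 (.fjmp 3) (by unfold nextBlock; split_ifs <;> rfl)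
  have h4 := hI j hj 4 (.basic (.aux (j + 1)) .setT)
    (by unfold nextBlock; split_ifs <;> rfl)
  have e := Reach.basic h4 (assignSt_aux (b := b) (a := a) hr)
  rw [updSt_assignSt_setT hr] at e
  exact ((Reach.test_pass h0 (by rw [assignSt_aux hr, ha])).trans (Reach.fjmp h1)).trans e

/-- If the registers `1, …, j` hold `t`, then execution either finds a satisfying assignment
or tries all values of these registers, restores them, and enters the next block. -/
theorem reach_search {B : ℕ} (hK : 0 < K) (hB : B + 1 = 9 * K) (hφ : VarsIn k K φ)
    (hC : ∀ j < K, BlockAt I (9 * j) (guarded K φ (j + 1)))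
    (hN : ∀ j < k, BlockAt I (B + 5 * j) (nextBlock k j))
    (hJ : I[B + 5 * k + 1]? = some (.bjmp (B + 5 * k + 1))) {j : ℕ} (hj : j ≤ k)
    (ha : ∀ i, 1 ≤ i → i ≤ j → a i = true) :
    ((∃ a', SatAll K φ b a') ∧
      ∃ s, Reach I (.running 1 (assignSt k b a)) (.terminated true s)) ∨
    ((∀ a', (∀ i, j < i → i ≤ k → a' i = a i) → ¬ SatAll K φ b a') ∧
      Reach I (.running 1 (assignSt k b a))
        (.running (B + 5 * j + 1) (assignSt k b a))) := by
  induction j generalizing a with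
  | zero =>
    rcases reach_check (b := b) (a := a) hφ hC hK with ⟨h, h'⟩ | ⟨⟨i, hi, hs⟩, h'⟩
    · exact .inl ⟨⟨a, fun i => h i (Nat.zero_le _)⟩, _, h'⟩
    · refine .inr ⟨fun a' haa hsat => hs ?_, by simpa [hB] using h'⟩
      exact (hsat i hi).congr hφ haa (by omega) (by omega)
  | succ j ih =>
    rcases ih (by omega) (fun i h1 hi => ha i h1 (by omega)) with h | ⟨h, hr⟩
    · exact .inl h
    have haj := ha (j + 1) (by omega) le_rfl
    set a₁ := Function.update a (j + 1) false with ha₁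
    have hback : Reach I (.running (B + 5 * k + 2) (assignSt k b a₁))
        (.running 1 (assignSt k b a₁)) := by
      simpa using Reach.bjmp (s := assignSt k b a₁) hJ le_rfl
    have hr₁ := (hr.trans (reach_next_true hN (by omega) haj)).trans hback
    rcases ih (a := a₁) (by omega) (fun i h1 hi => by
      rw [ha₁, Function.update_of_ne (by omega)]; exact ha i h1 (by omega)) with
      ⟨h₂, s, h₂'⟩ | ⟨h₂, h₂'⟩
    · exact .inl ⟨h₂, s, hr₁.trans h₂'⟩
    have hu : Function.update a₁ (j + 1) true = a := by
      rw [ha₁, Function.update_idem, ← haj, Function.update_eq_self]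
    have hn := reach_next_false (b := b) (a := a₁) hN (j := j) (by omega) (by simp [ha₁])
    rw [hu] at hn
    refine .inr ⟨fun a' haa => ?_, (hr₁.trans h₂').trans hn⟩
    cases hv : a' (j + 1) with
    | true =>
      refine h a' fun i hi hik => ?_
      rcases Nat.eq_or_lt_of_le (Nat.succ_le_of_lt hi) with rfl | hlt
      · rw [hv, haj]
      · exact haa i hlt hik
    | false =>
      refine h₂ a' fun i hi hik => ?_
      rcases Nat.eq_or_lt_of_le (Nat.succ_le_of_lt hi) with rfl | hlt
      · rw [hv, ha₁, Function.update_self]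
      · rw [ha₁, Function.update_of_ne (by omega)]
        exact haa i hlt hik

end Execution

theorem guarded_length_of_lt {K m : ℕ} (φ : ℕ → ℕ × ℕ × ℕ × ℕ) (h : m < K) :
    (guarded K φ m).length = 9 := by simp [guarded, h, CHECKc]

theorem length_CHECKseq {k : ℕ} (hk : 1 ≤ k) (φ : ℕ → ℕ × ℕ × ℕ × ℕ) :
    (CHECKseq k φ).length + 1 = 9 * (8 * k ^ 3) := by
  obtain ⟨n, hn⟩ := Nat.exists_eq_succ_of_ne_zero (show 8 * k ^ 3 ≠ 0 by positivity)
  rw [CHECKseq, hn, List.range_succ, List.flatMap_append, List.length_append,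
    length_flatMap_range _ 9 n fun j hj => guarded_length_of_lt φ (by omega)]
  simp [guarded, CHECKc]
  omega

theorem length_NEXT {k : ℕ} (hk : 1 ≤ k) : (NEXT k).length = 5 * k + 1 := by
  rw [NEXT, List.length_append, length_flatMap_range _ 5 _ fun j _ => rfl]
  simp [NEXTlast]
  omega

theorem blockAt_NEXT {k j : ℕ} (hj : j < k) : BlockAt (NEXT k) (5 * j) (nextBlock k j) := by
  unfold NEXT nextBlock
  split_ifs with h
  · exact (blockAt_flatMap_range (fun i => NEXTi (i + 1)) 5 (k - 1) (fun _ _ => rfl)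
      (by omega)).mono_left
  · obtain rfl : k = j + 1 := by omega
    have := (blockAt_self (L := NEXTlast (j + 1))).shift
      (L' := (List.range j).flatMap fun i => NEXTi (i + 1))
    rwa [length_flatMap_range _ 5 j fun _ _ => rfl] at this

theorem satFormula_iff_exists_satAll (k : ℕ) (φ : ℕ → ℕ × ℕ × ℕ × ℕ)
    (b : Fin (8 * k ^ 3) → Bool) :
    SatFormula k φ (List.ofFn b) ↔ ∃ a, SatAll (8 * k ^ 3) φ b a := by
  refine exists_congr fun a => ⟨fun h j hj => ?_, fun h m h1 hm hb => ?_⟩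
  · exact h (j + 1) (by omega) (by omega) (by simpa using hj)
  · obtain ⟨m, rfl⟩ := Nat.exists_eq_succ_of_ne_zero (show m ≠ 0 by omega)
    exact h ⟨m, by omega⟩ (by simpa [show m < 8 * k ^ 3 by omega] using hb)

theorem length_search {k : ℕ} (hk : 1 ≤ k) (φ : ℕ → ℕ × ℕ × ℕ × ℕ) :
    (CHECKseq k φ ++ NEXT k ++ [Instr.bjmp (72 * k ^ 3 + 5 * k)]).length
      = 72 * k ^ 3 + 5 * k + 1 := by
  have := length_CHECKseq hk φ
  simp only [List.length_append, length_NEXT hk, List.length_singleton]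
  omega

theorem computes_search {k : ℕ} (hk : 1 ≤ k) {φ : ℕ → ℕ × ℕ × ℕ × ℕ}
    (hφ : Set.MapsTo φ (Set.Icc 1 (8 * k ^ 3))
      (Set.Icc 1 k ×ˢ Set.Icc 1 k ×ˢ Set.Icc 1 k ×ˢ Set.Icc 1 8)) :
    Computes (CHECKseq k φ ++ NEXT k ++ [Instr.bjmp (72 * k ^ 3 + 5 * k)]) (8 * k ^ 3) k
      (fun b => some (if SatFormula k φ (List.ofFn b) then true else false)) := by
  have hlen := length_CHECKseq hk φ
  set B := (CHECKseq k φ).length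
  have hφ' : VarsIn k (8 * k ^ 3) φ := fun m h1 hm =>
    have h := hφ ⟨h1, hm⟩
    ⟨h.1, h.2.1, h.2.2.1⟩
  set I := CHECKseq k φ ++ NEXT k ++ [Instr.bjmp (72 * k ^ 3 + 5 * k)] with hI
  have hC : ∀ j < 8 * k ^ 3, BlockAt I (9 * j) (guarded (8 * k ^ 3) φ (j + 1)) := fun j hj =>
    (blockAt_flatMap_range (fun j => guarded (8 * k ^ 3) φ (j + 1)) 9 (8 * k ^ 3)
      (fun _ h => guarded_length_of_lt φ h) hj).mono_left.mono_left
  have hN : ∀ j < k, BlockAt I (B + 5 * j) (nextBlock k j) := fun j hj =>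
    (blockAt_NEXT hj).shift.mono_left
  have hJ : I[B + 5 * k + 1]? = some (.bjmp (B + 5 * k + 1)) := by
    have he : B + 5 * k + 1 = 72 * k ^ 3 + 5 * k := by omega
    have hl : (CHECKseq k φ ++ NEXT k).length = 72 * k ^ 3 + 5 * k := by
      rw [List.length_append, length_NEXT hk]
      omega
    rw [he, hI, List.getElem?_append_right hl.le, hl]
    simp
  intro b
  refine ⟨fun r hr => ?_, fun h => by simp at h⟩
  have hinit : initSt (8 * k ^ 3) k b = assignSt k b fun _ => true := by
    funext g
    cases g <;> rfl
  simp only [Option.some.injEq] at hr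
  subst hr
  rw [hinit]
  rcases reach_search (b := b) (a := fun _ => true) (by positivity) hlen hφ' hC hN hJ le_rfl
    (fun _ _ _ => rfl) with ⟨h, s, hs⟩ | ⟨h, hs⟩
  · rw [if_pos ((satFormula_iff_exists_satAll k φ b).2 h)]
    exact hs.termWith
  · rw [if_neg fun hsat => ?_]
    · have hF := hN (k - 1) (by omega) 5 .termF (by
        simp [nextBlock, NEXTlast, show ¬ k - 1 + 1 < k by omega])
      rw [show B + 5 * (k - 1) + 5 = B + 5 * k by omega] at hF
      exact (hs.trans (Reach.termF hF)).termWith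
    · obtain ⟨a, ha⟩ := (satFormula_iff_exists_satAll k φ b).1 hsat
      exact h a (fun i h1 h2 => by omega) ha

/-- The instruction sequence `I_k = CHECK; NEXT; \#(72k³ + 5k)` has length
`72k³ + 5k + 1`, contains a backward jump, and computes the total function
`3SAT(k) : Bool^{8k³} → Bool` using `k` auxiliary registers; consequently `3SAT(k)` is
computed by an instruction sequence of length polynomial in its number `8k³` of
inputs, i.e. `3SAT ∈ IS_P`. -/
theorem statement8 (k : ℕ) (hk : 1 ≤ k) (φ : ℕ → ℕ × ℕ × ℕ × ℕ)
    (hφ : Set.BijOn φ (Set.Icc 1 (8 * k ^ 3))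
      (Set.Icc 1 k ×ˢ Set.Icc 1 k ×ˢ Set.Icc 1 k ×ˢ Set.Icc 1 8)) :
    (CHECKseq k φ ++ NEXT k ++ [Instr.bjmp (72 * k ^ 3 + 5 * k)]).length
        = 72 * k ^ 3 + 5 * k + 1 ∧
    (∃ l : ℕ, Instr.bjmp l ∈ CHECKseq k φ ++ NEXT k ++ [Instr.bjmp (72 * k ^ 3 + 5 * k)]) ∧
    Computes (CHECKseq k φ ++ NEXT k ++ [Instr.bjmp (72 * k ^ 3 + 5 * k)])
      (8 * k ^ 3) k
      (fun b => some (if SatFormula k φ (List.ofFn b) then true else false)) ∧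
    (∃ p : Polynomial ℕ, ∀ k' : ℕ, 1 ≤ k' → ∀ φ' : ℕ → ℕ × ℕ × ℕ × ℕ,
      Set.BijOn φ' (Set.Icc 1 (8 * k' ^ 3))
        (Set.Icc 1 k' ×ˢ Set.Icc 1 k' ×ˢ Set.Icc 1 k' ×ˢ Set.Icc 1 8) →
      ∃ I : List Instr, I ≠ [] ∧ I.length ≤ p.eval (8 * k' ^ 3) ∧
        ∃ l : ℕ, Computes I (8 * k' ^ 3) l
          (fun b => some (if SatFormula k' φ' (List.ofFn b) then true else false))) := by
  refine ⟨length_search hk φ, ⟨_, List.mem_append_right _ (List.mem_singleton_self _)⟩,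
    computes_search hk hφ.mapsTo, 14 * Polynomial.X + 1, fun k' hk' φ' hφ' => ?_⟩
  refine ⟨_, List.append_ne_nil_of_right_ne_nil _ (List.cons_ne_nil _ _), ?_, k',
    computes_search hk' hφ'.mapsTo⟩
  have h3 : k' ≤ k' ^ 3 := Nat.le_self_pow (by norm_num) k'
  rw [length_search hk' φ']
  simp
  omega
end
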